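/- arXiv:2112.02715 — 3 statements merged into one kernel-verified Lean document; each statement's English description precedes it below -/
import Mathlib

section
/- Let n ≥ 1 be an integer, η > 0, p ∈ ℝⁿ, and let Q be a symmetric n×n real matrix. Then tr(a(p)·Q²) ≥ (tr(a(p)·Q))² / ((n − 1) + η²/(η² + |p|²)), where a(p) = Iₙ − (p ⊗ p)/(η² + |p|²). -/
noncomputable section

/-- The matrix `a(p) = Iₙ − (p ⊗ p)/(η² + |p|²)`. -/
def aMat (n : ℕ) (η : ℝ) (p : Fin n → ℝ) : Matrix (Fin n) (Fin n) ℝ :=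
  1 - (η ^ 2 + ∑ i, p i ^ 2)⁻¹ • Matrix.vecMulVec p p

/-- For positive semidefinite `A` and symmetric `Q`, the Cauchy–Schwarz inequality
`(tr (A Q))² ≤ tr A · tr (A Q²)`, in divided form. -/
theorem Matrix.PosSemidef.trace_mul_sq_div_trace_le {ι : Type*} [Fintype ι]
    {A Q : Matrix ι ι ℝ} (hA : A.PosSemidef) (hQ : Q.IsSymm) (htr : 0 < A.trace) :
    (A * Q).trace ^ 2 / A.trace ≤ (A * (Q * Q)).trace := by
  classical
  set c : ℝ := (A * Q).trace / A.trace with hc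
  have hS : (Q - c • (1 : Matrix ι ι ℝ)).conjTranspose = Q - c • 1 := by
    simp [Matrix.conjTranspose_eq_transpose_of_trivial, hQ.eq]
  have h := (hA.conjTranspose_mul_mul_same (Q - c • (1 : Matrix ι ι ℝ))).trace_nonneg
  rw [hS, Matrix.mul_assoc, Matrix.trace_mul_comm, Matrix.mul_assoc] at h
  have hexp : A * ((Q - c • (1 : Matrix ι ι ℝ)) * (Q - c • 1))
      = A * (Q * Q) - (2 * c) • (A * Q) + c ^ 2 • A := by
    simp only [sub_mul, mul_sub, smul_mul_assoc, mul_smul_comm, mul_one, one_mul]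
    module
  rw [hexp, Matrix.trace_add, Matrix.trace_sub, Matrix.trace_smul, Matrix.trace_smul,
    smul_eq_mul, smul_eq_mul] at h
  have hmul : c * A.trace = (A * Q).trace := div_mul_cancel₀ _ htr.ne'
  have hdiv : (A * Q).trace ^ 2 / A.trace = c * (A * Q).trace := by
    rw [hc]; ring
  rw [hdiv]
  linear_combination h + c * hmul

theorem posSemidef_aMat (n : ℕ) (η : ℝ) (p : Fin n → ℝ) : (aMat n η p).PosSemidef := by
  refine .of_dotProduct_mulVec_nonneg ?_ fun x ↦ ?_
  · ext i j
    simp [aMat, Matrix.vecMulVec_apply, Matrix.one_apply, eq_comm, mul_comm (p i)]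
  · have hv : 0 ≤ η ^ 2 + ∑ i, p i ^ 2 := by positivity
    have hquad : star x ⬝ᵥ (aMat n η p).mulVec x
        = ∑ i, x i ^ 2 - (∑ i, p i * x i) ^ 2 / (η ^ 2 + ∑ i, p i ^ 2) := by
      simp only [aMat, star_trivial, Matrix.sub_mulVec, Matrix.one_mulVec, Matrix.smul_mulVec,
        Matrix.vecMulVec_mulVec, dotProduct_sub, dotProduct_smul, op_smul_eq_smul, smul_eq_mul,
        dotProduct_comm x p]
      simp only [dotProduct, ← pow_two]
      ring
    rw [hquad, sub_nonneg]
    refine div_le_of_le_mul₀ hv (by positivity) ?_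
    have hx : 0 ≤ ∑ i, x i ^ 2 := by positivity
    nlinarith [Finset.sum_mul_sq_le_sq_mul_sq Finset.univ p x, mul_nonneg hx (sq_nonneg η)]

theorem trace_aMat (n : ℕ) (η : ℝ) (hη : 0 < η) (p : Fin n → ℝ) :
    (aMat n η p).trace = ((n : ℝ) - 1) + η ^ 2 / (η ^ 2 + ∑ i, p i ^ 2) := by
  have hv : η ^ 2 + ∑ i, p i ^ 2 ≠ 0 := by positivity
  simp only [aMat, Matrix.trace_sub, Matrix.trace_one, Matrix.trace_smul,
    Matrix.trace_vecMulVec, Fintype.card_fin, smul_eq_mul, dotProduct, ← pow_two]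
  field_simp
  ring

/-- For `n ≥ 1`, `η > 0`, `p ∈ ℝⁿ` and `Q` a symmetric `n×n` real matrix,
`tr(a(p)·Q²) ≥ (tr(a(p)·Q))² / ((n − 1) + η²/(η² + |p|²))`. -/
theorem trace_aMat_sq_lower_bound (n : ℕ) (hn : 1 ≤ n) (η : ℝ) (hη : 0 < η)
    (p : Fin n → ℝ) (Q : Matrix (Fin n) (Fin n) ℝ) (hQ : Q.IsSymm) :
    (Matrix.trace (aMat n η p * Q)) ^ 2 / (((n : ℝ) - 1) + η ^ 2 / (η ^ 2 + ∑ i, p i ^ 2))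
      ≤ Matrix.trace (aMat n η p * (Q * Q)) := by
  rw [← trace_aMat n η hη p]
  refine (posSemidef_aMat n η p).trace_mul_sq_div_trace_le hQ ?_
  rw [trace_aMat n η hη p]
  have hn' : (0 : ℝ) ≤ n - 1 := sub_nonneg.mpr (by exact_mod_cast hn)
  positivity
end
end

section
/- Let n ≥ 1 be an integer, η > 0, q > 0, let Ω ⊆ ℝⁿ be open, and let u : ℝⁿ → ℝ be three times continuously differentiable on Ω. Define v = √(η² + |Du|²) on Ω. Then for every x ∈ Ω, tr{a(Du(x))·D(v^q Dv)(x)} = v(x)^{q−1}·tr{(a(Du(x))·D²u(x))²} + q·v(x)^{q−1}·tr{a(Du(x))·(Dv(x) ⊗ Dv(x))} + v(x)^{q−1}·tr{a(Du(x))·(D³u(x) ⊙ Du(x))}, where a(p) = Iₙ − (p ⊗ p)/(η² + |p|²), D(v^q Dv) is the Jacobian matrix of the vector field x ↦ v(x)^q·Dv(x), and D³u ⊙ Du is the matrix with (i,j)-entry Σ_ℓ u_{x_ℓ x_i x_j}·u_{x_ℓ}. -/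
noncomputable section

open Matrix in
/-- The matrix identity behind the theorem: `M = I - w⁻¹ g ⊗ g` and `w d ⊗ d = Hg ⊗ Hg`. -/
theorem trace_identity_of_jacobian_eq {n : ℕ} (A H J T : Matrix (Fin n) (Fin n) ℝ)
    (g d : Fin n → ℝ) (w c q : ℝ)
    (hA : A = 1 - w⁻¹ • vecMulVec g g) (hH : Hᵀ = H)
    (hd : vecMulVec d d = w⁻¹ • vecMulVec (H *ᵥ g) (H *ᵥ g))
    (hJ : J = ((q - 1) * c) • vecMulVec d d + c • (H * H + T)) :
    trace (A * J) = c * trace (A * H * (A * H)) + q * c * trace (A * vecMulVec d d) +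
      c * trace (A * T) := by
  have hAH : A * H * (A * H) = A * (H * H) - A * vecMulVec d d := by
    have h : H * A * H = H * H - vecMulVec d d := by
      rw [hA, Matrix.mul_sub, Matrix.sub_mul, Matrix.mul_one, Matrix.mul_smul, Matrix.smul_mul,
        Matrix.mul_vecMulVec, Matrix.vecMulVec_mul, ← Matrix.mulVec_transpose, hH, hd]
    rw [← Matrix.mul_sub, ← h]
    simp only [Matrix.mul_assoc]
  rw [hAH, hJ]
  simp only [Matrix.mul_add, Matrix.mul_smul, Matrix.trace_add, Matrix.trace_sub,
    Matrix.trace_smul, smul_eq_mul]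
  ring

theorem gradient_apply_eq_fderiv_single {n : ℕ} (f : EuclideanSpace ℝ (Fin n) → ℝ)
    (y : EuclideanSpace ℝ (Fin n)) (i : Fin n) :
    gradient f y i = fderiv ℝ f y (EuclideanSpace.single i 1) := by
  rw [gradient, ← InnerProductSpace.toDual_symm_apply, EuclideanSpace.inner_single_right]
  simp

theorem ContDiffAt.fderiv_fderiv_apply_comm {E : Type*} [NormedAddCommGroup E] [NormedSpace ℝ E]
    {f : E → ℝ} {x : E} (hf : ContDiffAt ℝ 2 f x) (a b : E) :
    fderiv ℝ (fun y => fderiv ℝ f y a) x b = fderiv ℝ (fun y => fderiv ℝ f y b) x a := by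
  have hd : DifferentiableAt ℝ (fderiv ℝ f) x :=
    (hf.fderiv_right (m := 1) (by norm_num)).differentiableAt (by norm_num)
  have hsymm := hf.isSymmSndFDerivAt (by simp)
  have key : ∀ c d : E, fderiv ℝ (fun y => fderiv ℝ f y c) x d = fderiv ℝ (fderiv ℝ f) x d c := by
    intro c d
    rw [fderiv_clm_apply hd (differentiableAt_const c)]
    simp
  rw [key, key]
  exact hsymm.eq b a

/-- The derivative of `√(c + ∑ gₗ²)`. -/
theorem hasFDerivAt_sqrt_const_add_sum_sq {E ι : Type*} [NormedAddCommGroup E] [NormedSpace ℝ E]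
    [Fintype ι] {c : ℝ} (hc : 0 < c) {g : ι → E → ℝ} {y : E}
    (hg : ∀ l, DifferentiableAt ℝ (g l) y) :
    HasFDerivAt (fun z => Real.sqrt (c + ∑ l, g l z ^ 2))
      ((Real.sqrt (c + ∑ l, g l y ^ 2))⁻¹ • ∑ l, g l y • fderiv ℝ (g l) y) y := by
  have hpos : 0 < c + ∑ l, g l y ^ 2 := by positivity
  have h := ((HasFDerivAt.fun_sum (u := Finset.univ)
    fun l _ => (hg l).hasFDerivAt.pow 2).const_add c).sqrt hpos.ne'
  convert h using 1
  ext e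
  simp only [smul_apply, sum_apply, smul_eq_mul,
    Finset.mul_sum]
  refine Finset.sum_congr rfl fun l _ => ?_
  have := (Real.sqrt_pos.2 hpos).ne'
  simp
  field_simp

/-- Let `n ≥ 1`, `η > 0`, `q > 0`, `Ω ⊆ ℝⁿ` open, `u : ℝⁿ → ℝ` three times
continuously differentiable on `Ω`, and `v = √(η² + |Du|²)`.  Then for every
`x ∈ Ω`,
`tr{a(Du)·D(v^q Dv)} = v^{q−1}·tr{(a(Du)·D²u)²} + q·v^{q−1}·tr{a(Du)·(Dv ⊗ Dv)}
  + v^{q−1}·tr{a(Du)·(D³u ⊙ Du)}`,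
where `a(p) = Iₙ − (p ⊗ p)/(η² + |p|²)`, `D(v^q Dv)` is the Jacobian matrix of the
vector field `x ↦ v(x)^q·Dv(x)` (with `(i,j)`-entry the `x_j`-derivative of the
`i`-th component), and `(D³u ⊙ Du)ᵢⱼ = Σ_ℓ u_{x_ℓ x_i x_j}·u_{x_ℓ}`. -/
theorem trace_a_jacobian_identity (n : ℕ) (hn : 1 ≤ n) (η q : ℝ) (hη : 0 < η)
    (hq : 0 < q) (Ω : Set (EuclideanSpace ℝ (Fin n))) (hΩ : IsOpen Ω)
    (u : EuclideanSpace ℝ (Fin n) → ℝ) (hu : ContDiffOn ℝ 3 u Ω)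
    (x : EuclideanSpace ℝ (Fin n)) (hx : x ∈ Ω) :
    let v : EuclideanSpace ℝ (Fin n) → ℝ :=
      fun y => Real.sqrt (η ^ 2 + ‖gradient u y‖ ^ 2)
    let A : Matrix (Fin n) (Fin n) ℝ :=
      Matrix.of fun i j => (if i = j then (1 : ℝ) else 0) -
        gradient u x i * gradient u x j / (η ^ 2 + ‖gradient u x‖ ^ 2)
    let H : Matrix (Fin n) (Fin n) ℝ :=
      Matrix.of fun i j => fderiv ℝ (fun y => gradient u y j) x (EuclideanSpace.single i 1)
    let J : Matrix (Fin n) (Fin n) ℝ :=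
      Matrix.of fun i j => fderiv ℝ (fun y => v y ^ q * gradient v y i) x
        (EuclideanSpace.single j 1)
    let dv : Fin n → ℝ := fun i => gradient v x i
    let T : Matrix (Fin n) (Fin n) ℝ :=
      Matrix.of fun i j => ∑ ℓ, fderiv ℝ (fun y => fderiv ℝ (fun z => gradient u z j) y
          (EuclideanSpace.single i 1)) x (EuclideanSpace.single ℓ 1) * gradient u x ℓ
    Matrix.trace (A * J) =
      v x ^ (q - 1) * Matrix.trace (A * H * (A * H)) +
        q * v x ^ (q - 1) * Matrix.trace (A * Matrix.vecMulVec dv dv) +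
        v x ^ (q - 1) * Matrix.trace (A * T) := by
  intro v A H J dv T
  set e : Fin n → EuclideanSpace ℝ (Fin n) := fun i => EuclideanSpace.single i 1 with he
  set g : Fin n → EuclideanSpace ℝ (Fin n) → ℝ := fun i y => gradient u y i
  have hu3 : ∀ y ∈ Ω, ContDiffAt ℝ 3 u y := fun y hy => hu.contDiffAt (hΩ.mem_nhds hy)
  have hgeq : ∀ i, g i = fun y => fderiv ℝ u y (e i) := fun i =>
    funext fun y => gradient_apply_eq_fderiv_single u y i
  have hg2 : ∀ i, ∀ y ∈ Ω, ContDiffAt ℝ 2 (g i) y := by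
    intro i y hy
    rw [hgeq]
    exact ((hu3 y hy).fderiv_right (m := 2) (by norm_num)).clm_apply contDiffAt_const
  have hg1 : ∀ i, ∀ y ∈ Ω, DifferentiableAt ℝ (g i) y := fun i y hy =>
    (hg2 i y hy).differentiableAt (by norm_num)
  have hsymm : ∀ i j, ∀ y ∈ Ω, fderiv ℝ (g j) y (e i) = fderiv ℝ (g i) y (e j) := by
    intro i j y hy
    rw [hgeq, hgeq]
    exact ((hu3 y hy).of_le (by norm_num)).fderiv_fderiv_apply_comm _ _
  have hnear : ∀ᶠ y in nhds x, y ∈ Ω := hΩ.mem_nhds hx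
  have hthird : ∀ i j l, fderiv ℝ (fun y => fderiv ℝ (g j) y (e i)) x (e l) =
      fderiv ℝ (fun y => fderiv ℝ (g l) y (e i)) x (e j) := by
    intro i j l
    have hswap : ∀ a b, fderiv ℝ (fun y => fderiv ℝ (g a) y (e b)) x =
        fderiv ℝ (fun y => fderiv ℝ (g b) y (e a)) x := fun a b =>
      Filter.EventuallyEq.fderiv_eq (hnear.mono fun y hy => hsymm b a y hy)
    rw [hswap j i, (hg2 i x hx).fderiv_fderiv_apply_comm, hswap i l]
  have hw : ∀ y, η ^ 2 + ‖gradient u y‖ ^ 2 = η ^ 2 + ∑ l, g l y ^ 2 := fun y => by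
    rw [EuclideanSpace.real_norm_sq_eq]
  have hwpos : ∀ y, 0 < η ^ 2 + ∑ l, g l y ^ 2 := fun y => by positivity
  have hv : v = fun y => Real.sqrt (η ^ 2 + ∑ l, g l y ^ 2) :=
    funext fun y => congrArg Real.sqrt (hw y)
  have hvpos : ∀ y, 0 < v y := fun y => by
    rw [hv]
    exact Real.sqrt_pos.2 (hwpos y)
  have hv2 : v x ^ 2 = η ^ 2 + ∑ l, g l x ^ 2 := by
    rw [hv]
    exact Real.sq_sqrt (hwpos x).le
  have hvd : ∀ y ∈ Ω, HasFDerivAt v ((v y)⁻¹ • ∑ l, g l y • fderiv ℝ (g l) y) y := by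
    intro y hy
    rw [hv]
    exact hasFDerivAt_sqrt_const_add_sum_sq (by positivity) fun l => hg1 l y hy
  have hgv : ∀ y ∈ Ω, ∀ i, gradient v y i = (v y)⁻¹ * ∑ l, g l y * fderiv ℝ (g l) y (e i) := by
    intro y hy i
    rw [gradient_apply_eq_fderiv_single, (hvd y hy).fderiv]
    simp [he]
  have hHg : ∀ i, (H.mulVec fun l => g l x) i = v x * dv i := by
    intro i
    simp only [dv, hgv x hx i]
    rw [mul_inv_cancel_left₀ (hvpos x).ne']
    change ∑ l, fderiv ℝ (g l) x (e i) * g l x = _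
    exact Finset.sum_congr rfl fun l _ => mul_comm _ _
  refine trace_identity_of_jacobian_eq A H J T (fun l => g l x) dv (v x ^ 2) (v x ^ (q - 1)) q
    ?_ ?_ ?_ ?_
  · ext i j
    simp only [A, hw x, hv2, Matrix.of_apply, Matrix.sub_apply, Matrix.smul_apply,
      Matrix.vecMulVec_apply, Matrix.one_apply, smul_eq_mul]
    rw [div_eq_inv_mul]
  · ext i j
    exact hsymm j i x hx
  · ext i j
    have := (hvpos x).ne'
    simp only [Matrix.smul_apply, Matrix.vecMulVec_apply, smul_eq_mul, hHg]
    field_simp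
  · ext i j
    have hev : (fun y => v y ^ q * gradient v y i) =ᶠ[nhds x]
        fun y => v y ^ (q - 1) * ∑ l, g l y * fderiv ℝ (g l) y (e i) := by
      filter_upwards [hnear] with y hy
      rw [hgv y hy i, Real.rpow_sub_one (hvpos y).ne']
      ring
    have hD : ∀ l, DifferentiableAt ℝ (fun y => fderiv ℝ (g l) y (e i)) x := fun l =>
      (((hg2 l x hx).fderiv_right (m := 1) (by norm_num)).clm_apply
        contDiffAt_const).differentiableAt (by norm_num)
    have hS := HasFDerivAt.fun_sum (u := Finset.univ) fun l _ =>
      (hg1 l x hx).hasFDerivAt.mul (hD l).hasFDerivAt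
    have hprod := ((hvd x hx).rpow_const (p := q - 1) (Or.inl (hvpos x).ne')).mul hS
    have hJ : J i j = _ := congrArg (fun L => L (e j)) (hev.fderiv_eq.trans hprod.fderiv)
    have hSi : ∑ l, g l x * fderiv ℝ (g l) x (e i) = v x * dv i := by
      simp only [dv, hgv x hx i]
      rw [mul_inv_cancel_left₀ (hvpos x).ne']
    have hdj : (v x)⁻¹ * ∑ l, g l x * fderiv ℝ (g l) x (e j) = dv j := (hgv x hx j).symm
    have hHH : (H * H) i j = ∑ l, fderiv ℝ (g l) x (e i) * fderiv ℝ (g l) x (e j) := by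
      rw [Matrix.mul_apply]
      exact Finset.sum_congr rfl fun l _ => congrArg _ (hsymm l j x hx)
    have hT : T i j = ∑ l, g l x * fderiv ℝ (fun y => fderiv ℝ (g l) y (e i)) x (e j) := by
      change ∑ l, fderiv ℝ (fun y => fderiv ℝ (g j) y (e i)) x (e l) * g l x = _
      exact Finset.sum_congr rfl fun l _ => by rw [mul_comm, hthird i j l]
    rw [hJ]
    simp only [Matrix.add_apply, Matrix.smul_apply, Matrix.vecMulVec_apply, smul_eq_mul, hHH, hT,
      add_apply, smul_apply,
      sum_apply, Pi.mul_apply, hSi, hdj, Finset.sum_add_distrib]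
    rw [Real.rpow_sub_one (hvpos x).ne' (q - 1)]
    have := (hvpos x).ne'
    field_simp
    ring
end
end

section
/- Let n ≥ 2 be an integer and R > 0. Let c : ℝ → ℝ be continuously differentiable on [0,R] and suppose that (1/(n−1))·c(r)² − |c'(r)| > 0 for every r ∈ [0,R]. Then there is at most one r ∈ (0,R] such that c(r) = (n−1)/r; that is, the curves r ↦ c(r) and r ↦ (n−1)/r cross in at most one point of (0,R]. -/
noncomputable section

/-- If `|c'| < c² / m` on `[0,R]`, then `r ↦ m / c r - r` is strictly decreasing there. -/
theorem strictAntiOn_div_sub_id {m R : ℝ} (hm : 0 < m) {c c' : ℝ → ℝ}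
    (hderiv : ∀ r ∈ Set.Icc 0 R, HasDerivWithinAt c (c' r) (Set.Icc 0 R) r)
    (hcoercive : ∀ r ∈ Set.Icc 0 R, 0 < 1 / m * c r ^ 2 - |c' r|) :
    StrictAntiOn (fun r => m / c r - r) (Set.Icc 0 R) := by
  have hne : ∀ r ∈ Set.Icc 0 R, c r ≠ 0 := by
    intro r hr h0
    have h := hcoercive r hr
    rw [h0] at h
    linarith [abs_nonneg (c' r)]
  have hd : ∀ r ∈ Set.Icc 0 R, HasDerivWithinAt (fun r => m / c r - r)
      ((0 * c r - m * c' r) / c r ^ 2 - 1) (Set.Icc 0 R) r := fun r hr =>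
    ((hasDerivWithinAt_const r _ m).fun_div (hderiv r hr) (hne r hr)).fun_sub
      (hasDerivWithinAt_id r _)
  refine strictAntiOn_of_hasDerivWithinAt_neg (convex_Icc 0 R)
    (fun r hr => (hd r hr).continuousWithinAt)
    (fun r hr => (hd r (interior_subset hr)).mono interior_subset) fun r hr => ?_
  have hr' := interior_subset hr
  have hsq : 0 < c r ^ 2 := by have := hne r hr'; positivity
  have h : -c' r < c r ^ 2 / m := by
    have h1 := hcoercive r hr'
    rw [one_div_mul_eq_div] at h1
    linarith [neg_abs_le (c' r)]
  rw [lt_div_iff₀ hm] at h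
  rw [sub_neg, div_lt_one hsq]
  linarith

/-- Let `n ≥ 2`, `R > 0` and `c : ℝ → ℝ` be continuously differentiable on `[0,R]`
(with derivative `c'` there), satisfying the coercivity condition
`(1/(n−1))·c(r)² − |c'(r)| > 0` on `[0,R]`.  Then there is at most one
`r ∈ (0,R]` with `c(r) = (n−1)/r`: the curves `r ↦ c(r)` and `r ↦ (n−1)/r`
cross in at most one point of `(0,R]`. -/
theorem at_most_one_crossing (n : ℕ) (hn : 2 ≤ n) (R : ℝ) (hR : 0 < R)
    (c c' : ℝ → ℝ)
    (hderiv : ∀ r ∈ Set.Icc 0 R, HasDerivWithinAt c (c' r) (Set.Icc 0 R) r)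
    (hcont : ContinuousOn c' (Set.Icc 0 R))
    (hcoercive : ∀ r ∈ Set.Icc 0 R, 0 < 1 / ((n : ℝ) - 1) * c r ^ 2 - |c' r|) :
    Set.Subsingleton {r ∈ Set.Ioc 0 R | c r = ((n : ℝ) - 1) / r} := by
  have hm : (0 : ℝ) < (n : ℝ) - 1 := by
    have : (2 : ℝ) ≤ n := by exact_mod_cast hn
    linarith
  have hzero : ∀ r : ℝ, c r = ((n : ℝ) - 1) / r → ((n : ℝ) - 1) / c r - r = 0 := by
    intro r h
    rw [h, div_div_cancel₀ hm.ne', sub_self]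
  rintro x ⟨hx, hcx⟩ y ⟨hy, hcy⟩
  exact (strictAntiOn_div_sub_id hm hderiv hcoercive).injOn
    (Set.Ioc_subset_Icc_self hx) (Set.Ioc_subset_Icc_self hy)
    ((hzero x hcx).trans (hzero y hcy).symm)
end
end
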